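/- arXiv:2109.13906 — 7 statements merged into one kernel-verified Lean document; each statement's English description precedes it below -/
import Mathlib

section
/- Let β : ℝ → ℝ be a continuous function, B(t) = ∫₀ᵗ β(τ) dτ, and let Θ_uu, Θ_ll, Θ_ln, Θ_nn be real numbers. Let I ⊆ ℝ be an interval containing 0 such that 1 − Θ_uu·B(t) ≠ 0 for all t ∈ I. Then the functions defined on I by Θ_uu(t) = Θ_uu/(1 − Θ_uu·B(t)), Θ_ll(t) = Θ_ll/(1 − Θ_uu·B(t)), Θ_ln(t) = Θ_ln/(1 − Θ_uu·B(t)), Θ_nn(t) = Θ_nn/(1 − Θ_uu·B(t)) are differentiable, take the values Θ_uu, Θ_ll, Θ_ln, Θ_nn at t = 0, and satisfy on I the differential system Θ_uu'(t) = β(t)·Θ_uu(t)², Θ_ll'(t) = β(t)·Θ_ll(t)·Θ_uu(t), Θ_ln'(t) = β(t)·Θ_ln(t)·Θ_uu(t), Θ_nn'(t) = β(t)·Θ_nn(t)·Θ_uu(t). -/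
open Real

/-- If `B` has derivative `b` at `t`, then `c / (1 - a * B)` has derivative
`b * (c / (1 - a * B t) * (a / (1 - a * B t)))` at `t`. -/
theorem HasDerivAt.const_div_one_sub_const_mul {B : ℝ → ℝ} {b t : ℝ} (hB : HasDerivAt B b t)
    (a c : ℝ) (h : 1 - a * B t ≠ 0) :
    HasDerivAt (fun s => c / (1 - a * B s))
      (b * (c / (1 - a * B t) * (a / (1 - a * B t)))) t := by
  refine ((hasDerivAt_const t c).fun_div ((hB.const_mul a).const_sub 1) h).congr_deriv ?_
  field_simp
  ring

/-- Explicit solution of the quasi-diagonal integrability system of the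
left-invariant parallel spinor flow (case `Θ_ul = Θ_un = 0`). -/
theorem stmt_0
    (β B : ℝ → ℝ) (hβ : Continuous β)
    (hB : ∀ t, B t = ∫ τ in (0:ℝ)..t, β τ)
    (Θuu Θll Θln Θnn : ℝ)
    (I : Set ℝ) (hI : I.OrdConnected) (h0 : (0:ℝ) ∈ I)
    (hden : ∀ t ∈ I, 1 - Θuu * B t ≠ 0)
    (Fuu Fll Fln Fnn : ℝ → ℝ)
    (hFuu : ∀ t, Fuu t = Θuu / (1 - Θuu * B t))
    (hFll : ∀ t, Fll t = Θll / (1 - Θuu * B t))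
    (hFln : ∀ t, Fln t = Θln / (1 - Θuu * B t))
    (hFnn : ∀ t, Fnn t = Θnn / (1 - Θuu * B t)) :
    Fuu 0 = Θuu ∧ Fll 0 = Θll ∧ Fln 0 = Θln ∧ Fnn 0 = Θnn ∧
    ∀ t ∈ I,
      HasDerivWithinAt Fuu (β t * (Fuu t) ^ 2) I t ∧
      HasDerivWithinAt Fll (β t * (Fll t * Fuu t)) I t ∧
      HasDerivWithinAt Fln (β t * (Fln t * Fuu t)) I t ∧
      HasDerivWithinAt Fnn (β t * (Fnn t * Fuu t)) I t := by
  have hB0 : B 0 = 0 := by simp [hB]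
  obtain rfl : Fuu = _ := funext hFuu
  obtain rfl : Fll = _ := funext hFll
  obtain rfl : Fln = _ := funext hFln
  obtain rfl : Fnn = _ := funext hFnn
  refine ⟨by simp [hB0], by simp [hB0], by simp [hB0], by simp [hB0], fun t ht => ?_⟩
  have hBt : HasDerivAt B (β t) t := by
    rw [funext hB]
    exact hβ.integral_hasStrictDerivAt 0 t |>.hasDerivAt
  have key (c : ℝ) := (hBt.const_div_one_sub_const_mul Θuu c (hden t ht)).hasDerivWithinAt (s := I)
  exact ⟨by simpa only [sq] using key Θuu, key Θll, key Θln, key Θnn⟩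
end

section
/- Let β : ℝ → ℝ be a continuous function, B(t) = ∫₀ᵗ β(τ) dτ, and let Θ_uu, Θ_ll, Θ_ln, Θ_nn be real numbers. Let I ⊆ ℝ be an interval containing 0 on which 1 − Θ_uu·B(t) ≠ 0, and suppose f_uu, f_ll, f_ln, f_nn : I → ℝ are differentiable functions satisfying f_uu' = β·f_uu², f_ll' = β·f_ll·f_uu, f_ln' = β·f_ln·f_uu, f_nn' = β·f_nn·f_uu on I, with f_uu(0) = Θ_uu, f_ll(0) = Θ_ll, f_ln(0) = Θ_ln, f_nn(0) = Θ_nn. Then for all t ∈ I, f_uu(t) = Θ_uu/(1 − Θ_uu·B(t)), f_ll(t) = Θ_ll/(1 − Θ_uu·B(t)), f_ln(t) = Θ_ln/(1 − Θ_uu·B(t)), and f_nn(t) = Θ_nn/(1 − Θ_uu·B(t)). -/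
open Real

/-- A function whose derivative within an order-connected set vanishes is constant there. -/
theorem eq_of_hasDerivWithinAt_zero {f : ℝ → ℝ} {s : Set ℝ} (hs : s.OrdConnected)
    (hf : ∀ x ∈ s, HasDerivWithinAt f 0 s x) {x y : ℝ} (hx : x ∈ s) (hy : y ∈ s) :
    f y = f x := by
  have h := hs.convex.norm_image_sub_le_of_norm_hasDerivWithin_le (C := 0) hf (by simp) hx hy
  rw [zero_mul] at h
  exact sub_eq_zero.mp (norm_le_zero_iff.mp h)

/-- A solution of the homogeneous linear equation `u' = a u` on an order-connected set that
vanishes at one point vanishes identically. -/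
theorem eq_zero_of_hasDerivWithinAt_mul_self {a u : ℝ → ℝ} {s : Set ℝ} (hs : s.OrdConnected)
    (ha : ContinuousOn a s) (hu : ∀ x ∈ s, HasDerivWithinAt u (a x * u x) s x)
    {x y : ℝ} (hx : x ∈ s) (hy : y ∈ s) (hux : u x = 0) : u y = 0 := by
  have hsub : Set.uIcc x y ⊆ s := hs.uIcc_subset hx hy
  let b : ℝ → ℝ := Set.IccExtend inf_le_sup ((Set.Icc (x ⊓ y) (x ⊔ y)).domRestrict a)
  have hb : Continuous b := (ha.mono hsub).domRestrict.Icc_extend'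
  have hba : ∀ r ∈ Set.uIcc x y, b r = a r := fun r hr =>
    Set.IccExtend_of_mem inf_le_sup ((Set.Icc (x ⊓ y) (x ⊔ y)).domRestrict a) hr
  have hderiv : ∀ r ∈ Set.uIcc x y, HasDerivWithinAt
      (fun r => u r * Real.exp (-∫ τ in x..r, b τ)) 0 (Set.uIcc x y) r := by
    intro r hr
    have hA : HasDerivAt (fun r => ∫ τ in x..r, b τ) (b r) r :=
      (hb.integral_hasStrictDerivAt x r).hasDerivAt
    refine (((hu r (hsub hr)).mono hsub).mul hA.neg.exp.hasDerivWithinAt).congr_deriv ?_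
    rw [hba r hr]
    ring
  have h := eq_of_hasDerivWithinAt_zero Set.ordConnected_uIcc hderiv
    Set.left_mem_uIcc Set.right_mem_uIcc
  simpa [hux, Real.exp_ne_zero] using h

/-- Uniqueness part of the explicit solution of the quasi-diagonal integrability
system of the left-invariant parallel spinor flow (case `Θ_ul = Θ_un = 0`). -/
theorem stmt_1
    (β B : ℝ → ℝ) (hβ : Continuous β)
    (hB : ∀ t, B t = ∫ τ in (0:ℝ)..t, β τ)
    (Θuu Θll Θln Θnn : ℝ)
    (I : Set ℝ) (hI : I.OrdConnected) (h0 : (0:ℝ) ∈ I)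
    (hden : ∀ t ∈ I, 1 - Θuu * B t ≠ 0)
    (Fuu Fll Fln Fnn : ℝ → ℝ)
    (hode : ∀ t ∈ I,
      HasDerivWithinAt Fuu (β t * (Fuu t) ^ 2) I t ∧
      HasDerivWithinAt Fll (β t * (Fll t * Fuu t)) I t ∧
      HasDerivWithinAt Fln (β t * (Fln t * Fuu t)) I t ∧
      HasDerivWithinAt Fnn (β t * (Fnn t * Fuu t)) I t)
    (h0uu : Fuu 0 = Θuu) (h0ll : Fll 0 = Θll)
    (h0ln : Fln 0 = Θln) (h0nn : Fnn 0 = Θnn) :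
    ∀ t ∈ I,
      Fuu t = Θuu / (1 - Θuu * B t) ∧
      Fll t = Θll / (1 - Θuu * B t) ∧
      Fln t = Θln / (1 - Θuu * B t) ∧
      Fnn t = Θnn / (1 - Θuu * B t) := by
  have hD : ∀ t, HasDerivAt (fun t => 1 - Θuu * B t) (-(Θuu * β t)) t := by
    intro t
    rw [funext hB]
    exact ((hβ.integral_hasStrictDerivAt 0 t).hasDerivAt.const_mul Θuu).const_sub 1
  have hB0 : B 0 = 0 := by simp [hB]
  have hFuu : ∀ t ∈ I, Fuu t * (1 - Θuu * B t) - Θuu = 0 := by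
    intro t ht
    refine eq_zero_of_hasDerivWithinAt_mul_self (a := fun t => β t * Fuu t)
      (u := fun t => Fuu t * (1 - Θuu * B t) - Θuu) hI
      (hβ.continuousOn.mul fun x hx => (hode x hx).1.continuousWithinAt) ?_ h0 ht
      (by simp [hB0, h0uu])
    intro x hx
    refine (((hode x hx).1.mul (hD x).hasDerivWithinAt).sub_const Θuu).congr_deriv ?_
    ring
  have hlin : ∀ (f : ℝ → ℝ) (c : ℝ), (∀ t ∈ I, HasDerivWithinAt f (β t * (f t * Fuu t)) I t) →
      f 0 = c → ∀ t ∈ I, f t = c / (1 - Θuu * B t) := by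
    intro f c hf hc t ht
    have hconst := eq_of_hasDerivWithinAt_zero (f := fun t => f t * (1 - Θuu * B t)) hI
      (fun x hx => ((hf x hx).mul (hD x).hasDerivWithinAt).congr_deriv
        (by linear_combination β x * f x * hFuu x hx)) h0 ht
    rw [eq_div_iff (hden t ht)]
    simpa [hB0, hc] using hconst
  intro t ht
  exact ⟨(eq_div_iff (hden t ht)).mpr (sub_eq_zero.mp (hFuu t ht)),
    hlin Fll Θll (fun x hx => (hode x hx).2.1) h0ll t ht,
    hlin Fln Θln (fun x hx => (hode x hx).2.2.1) h0ln t ht,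
    hlin Fnn Θnn (fun x hx => (hode x hx).2.2.2) h0nn t ht⟩
end

section
/- Let β : ℝ → ℝ be continuous, B(t) = ∫₀ᵗ β(τ) dτ, and let (Θ_uu, Θ_ul, Θ_un, Θ_ll, Θ_ln, Θ_nn) be real numbers satisfying the algebraic constraint equations and with λ := √(Θ_ul² + Θ_un²) > 0. Set y(t) = λ·B(t) + arctan(Θ_uu/λ), and define constants c_ll = (Θ_ll·λ² + Θ_ul²·Θ_uu)/(λ·√(λ² + Θ_uu²)), c_nn = (Θ_nn·λ² + Θ_un²·Θ_uu)/(λ·√(λ² + Θ_uu²)), c_ln = (Θ_ln·λ² + Θ_ul·Θ_un·Θ_uu)/(λ·√(λ² + Θ_uu²)). Let I ⊆ ℝ be an interval containing 0 with |y(t)| < π/2 for all t ∈ I. Then the functions Θ_uu(t) = λ·tan(y(t)), Θ_ul(t) = Θ_ul, Θ_un(t) = Θ_un, Θ_ll(t) = c_ll/cos(y(t)) − (Θ_ul²/λ)·tan(y(t)), Θ_nn(t) = c_nn/cos(y(t)) − (Θ_un²/λ)·tan(y(t)), Θ_ln(t) = c_ln/cos(y(t)) − (Θ_ul·Θ_un/λ)·tan(y(t))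 satisfy the integrability system on I and take the values (Θ_uu, Θ_ul, Θ_un, Θ_ll, Θ_ln, Θ_nn) at t = 0. -/
open Real

theorem hasDerivAt_mul_tan {y : ℝ → ℝ} {y' t : ℝ} (k : ℝ) (hy : HasDerivAt y y' t)
    (hc : cos (y t) ≠ 0) :
    HasDerivAt (fun s => k * tan (y s)) (k * ((1 + tan (y t) ^ 2) * y')) t := by
  have h := ((Real.hasDerivAt_tan hc).comp t hy).const_mul k
  refine h.congr_deriv ?_
  rw [← Real.inv_one_add_tan_sq hc]
  simp

theorem hasDerivAt_div_cos_sub_mul_tan {y : ℝ → ℝ} {y' t : ℝ} (c k : ℝ)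
    (hy : HasDerivAt y y' t) (hc : cos (y t) ≠ 0) :
    HasDerivAt (fun s => c / cos (y s) - k * tan (y s))
      ((c / cos (y t) * tan (y t) - k * (1 + tan (y t) ^ 2)) * y') t := by
  have h := ((hasDerivAt_const t c).fun_div hy.cos hc).sub (hasDerivAt_mul_tan k hy hc)
  refine h.congr_deriv ?_
  rw [Real.tan_eq_sin_div_cos]
  field_simp
  ring

/-- The value at `y = arctan (u / l)` of `c / cos y - (m / l) * tan y`, where the coefficient `c`
is normalised so that the value is `x`. -/
theorem div_cos_arctan_sub_mul_tan_arctan {l : ℝ} (hl : 0 < l) (u x m : ℝ) :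
    (x * l ^ 2 + m * u) / (l * √(l ^ 2 + u ^ 2)) / cos (arctan (u / l))
      - m / l * tan (arctan (u / l)) = x := by
  have hs : 0 < √(l ^ 2 + u ^ 2) := Real.sqrt_pos.2 (by positivity)
  have hcos : cos (arctan (u / l)) = l / √(l ^ 2 + u ^ 2) := by
    have h : 1 + (u / l) ^ 2 = (l ^ 2 + u ^ 2) / l ^ 2 := by field_simp
    rw [Real.cos_arctan, h, Real.sqrt_div (by positivity), Real.sqrt_sq hl.le, one_div_div]
  rw [hcos, Real.tan_arctan]
  field_simp
  ring

/-- Explicit solution of the integrability system of the left-invariant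
parallel spinor flow in the non-quasi-diagonal case `λ = √(Θ_ul² + Θ_un²) > 0`:
the stated functions satisfy the ODEs, the algebraic constraints at every
`t ∈ I`, and the prescribed initial values at `t = 0`. -/
theorem stmt_3
    (β B : ℝ → ℝ) (hβ : Continuous β)
    (hB : ∀ t, B t = ∫ τ in (0:ℝ)..t, β τ)
    (Θuu Θul Θun Θll Θln Θnn : ℝ)
    -- the algebraic constraint equations for the initial data
    (hc1 : Θln * Θul = Θll * Θun)
    (hc2 : Θln * Θun = Θnn * Θul)
    (hc3 : Θll * Θul + Θln * Θun + Θul * Θuu = 0)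
    (hc4 : Θln * Θul + Θnn * Θun + Θun * Θuu = 0)
    (lam : ℝ) (hlam : lam = Real.sqrt (Θul ^ 2 + Θun ^ 2)) (hlampos : 0 < lam)
    (y : ℝ → ℝ) (hy : ∀ t, y t = lam * B t + arctan (Θuu / lam))
    (cll cnn cln : ℝ)
    (hcll : cll = (Θll * lam ^ 2 + Θul ^ 2 * Θuu) / (lam * Real.sqrt (lam ^ 2 + Θuu ^ 2)))
    (hcnn : cnn = (Θnn * lam ^ 2 + Θun ^ 2 * Θuu) / (lam * Real.sqrt (lam ^ 2 + Θuu ^ 2)))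
    (hcln : cln = (Θln * lam ^ 2 + Θul * Θun * Θuu) / (lam * Real.sqrt (lam ^ 2 + Θuu ^ 2)))
    (I : Set ℝ) (hI : I.OrdConnected) (h0 : (0:ℝ) ∈ I)
    (hsmall : ∀ t ∈ I, |y t| < π / 2)
    (Fuu Ful Fun Fll Fln Fnn : ℝ → ℝ)
    (hFuu : ∀ t, Fuu t = lam * tan (y t))
    (hFul : ∀ t, Ful t = Θul)
    (hFun : ∀ t, Fun t = Θun)
    (hFll : ∀ t, Fll t = cll / cos (y t) - (Θul ^ 2 / lam) * tan (y t))
    (hFnn : ∀ t, Fnn t = cnn / cos (y t) - (Θun ^ 2 / lam) * tan (y t))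
    (hFln : ∀ t, Fln t = cln / cos (y t) - (Θul * Θun / lam) * tan (y t)) :
    -- initial values
    (Fuu 0 = Θuu ∧ Ful 0 = Θul ∧ Fun 0 = Θun ∧
     Fll 0 = Θll ∧ Fln 0 = Θln ∧ Fnn 0 = Θnn) ∧
    -- the ODEs of the integrability system
    (∀ t ∈ I,
      HasDerivWithinAt Fuu (β t * ((Fuu t) ^ 2 + (Ful t) ^ 2 + (Fun t) ^ 2)) I t ∧
      HasDerivWithinAt Ful 0 I t ∧
      HasDerivWithinAt Fun 0 I t ∧
      HasDerivWithinAt Fll (β t * (Fll t * Fuu t - (Ful t) ^ 2)) I t ∧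
      HasDerivWithinAt Fln (β t * (Fln t * Fuu t - Fun t * Ful t)) I t ∧
      HasDerivWithinAt Fnn (β t * (Fnn t * Fuu t - (Fun t) ^ 2)) I t) ∧
    -- the algebraic constraint equations at every time
    (∀ t ∈ I,
      Fln t * Ful t = Fll t * Fun t ∧
      Fln t * Fun t = Fnn t * Ful t ∧
      Fll t * Ful t + Fln t * Fun t + Ful t * Fuu t = 0 ∧
      Fln t * Ful t + Fnn t * Fun t + Fun t * Fuu t = 0) := by
  have hl0 : lam ≠ 0 := hlampos.ne'
  have hlsq : lam ^ 2 = Θul ^ 2 + Θun ^ 2 := by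
    rw [hlam, Real.sq_sqrt (by positivity)]
  have hy0 : y 0 = arctan (Θuu / lam) := by simp [hy, hB]
  have hdy (t : ℝ) : HasDerivAt y (lam * β t) t := by
    have hBt : HasDerivAt B (β t) t := by
      rw [funext hB]
      exact (hβ.integral_hasStrictDerivAt 0 t).hasDerivAt
    rw [funext hy]
    exact (hBt.const_mul lam).add_const _
  have hcos (t : ℝ) (ht : t ∈ I) : cos (y t) ≠ 0 :=
    (Real.cos_pos_of_mem_Ioo (abs_lt.1 (hsmall t ht))).ne'
  refine ⟨⟨?_, hFul 0, hFun 0, ?_, ?_, ?_⟩, fun t ht => ⟨?_, ?_, ?_, ?_, ?_, ?_⟩, fun t _ => ?_⟩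
  · rw [hFuu, hy0, Real.tan_arctan]
    field_simp
  · rw [hFll, hy0, hcll, div_cos_arctan_sub_mul_tan_arctan hlampos]
  · rw [hFln, hy0, hcln, div_cos_arctan_sub_mul_tan_arctan hlampos]
  · rw [hFnn, hy0, hcnn, div_cos_arctan_sub_mul_tan_arctan hlampos]
  · rw [hFuu, hFul, hFun, funext hFuu]
    refine ((hasDerivAt_mul_tan lam (hdy t) (hcos t ht)).congr_deriv ?_).hasDerivWithinAt
    linear_combination β t * hlsq
  · rw [funext hFul]
    exact hasDerivWithinAt_const t I Θul
  · rw [funext hFun]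
    exact hasDerivWithinAt_const t I Θun
  · rw [hFll, hFuu, hFul, funext hFll]
    refine ((hasDerivAt_div_cos_sub_mul_tan _ _ (hdy t)
      (hcos t ht)).congr_deriv ?_).hasDerivWithinAt
    field_simp
    ring
  · rw [hFln, hFuu, hFul, hFun, funext hFln]
    refine ((hasDerivAt_div_cos_sub_mul_tan _ _ (hdy t)
      (hcos t ht)).congr_deriv ?_).hasDerivWithinAt
    field_simp
    ring
  · rw [hFnn, hFuu, hFun, funext hFnn]
    refine ((hasDerivAt_div_cos_sub_mul_tan _ _ (hdy t)
      (hcos t ht)).congr_deriv ?_).hasDerivWithinAt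
    field_simp
    ring
  · have h1 : cln * Θul = cll * Θun := by
      rw [hcln, hcll, div_mul_eq_mul_div, div_mul_eq_mul_div]
      congr 1
      linear_combination lam ^ 2 * hc1
    have h2 : cln * Θun = cnn * Θul := by
      rw [hcln, hcnn, div_mul_eq_mul_div, div_mul_eq_mul_div]
      congr 1
      linear_combination lam ^ 2 * hc2
    have h3 : cll * Θul + cln * Θun = 0 := by
      rw [hcll, hcln, div_mul_eq_mul_div, div_mul_eq_mul_div, ← add_div, div_eq_zero_iff]
      left
      linear_combination lam ^ 2 * hc3 - Θul * Θuu * hlsq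
    have h4 : cln * Θul + cnn * Θun = 0 := by
      rw [hcln, hcnn, div_mul_eq_mul_div, div_mul_eq_mul_div, ← add_div, div_eq_zero_iff]
      left
      linear_combination lam ^ 2 * hc4 - Θun * Θuu * hlsq
    have hl : lam = (Θul ^ 2 + Θun ^ 2) / lam := by
      rw [← hlsq]
      field_simp
    rw [hFuu, hFul, hFun, hFll, hFln, hFnn]
    refine ⟨?_, ?_, ?_, ?_⟩
    · linear_combination (cos (y t))⁻¹ * h1
    · linear_combination (cos (y t))⁻¹ * h2
    · linear_combination (cos (y t))⁻¹ * h3 + Θul * tan (y t) * hl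
    · linear_combination (cos (y t))⁻¹ * h4 + Θun * tan (y t) * hl
end

section
/- Let β : ℝ → ℝ be continuous, B(t) = ∫₀ᵗ β(τ) dτ, and let t ↦ (Θ_uu(t), Θ_ul(t), Θ_un(t), Θ_ll(t), Θ_ln(t), Θ_nn(t)) be differentiable functions on an interval I containing 0 satisfying the integrability system, with initial values (Θ_uu, Θ_ul, Θ_un, Θ_ll, Θ_ln, Θ_nn) at t = 0 and λ := √(Θ_ul² + Θ_un²) > 0. Set y(t) = λ·B(t) + arctan(Θ_uu/λ) and c_ll = (Θ_ll·λ² + Θ_ul²·Θ_uu)/(λ·√(λ² + Θ_uu²)), c_nn = (Θ_nn·λ² + Θ_un²·Θ_uu)/(λ·√(λ² + Θ_uu²)), c_ln = (Θ_ln·λ² + Θ_ul·Θ_un·Θ_uu)/(λ·√(λ² + Θ_uu²)). Then the initial values satisfy the algebraic constraint equations, and for every t ∈ I one has cos(y(t)) ≠ 0, Θ_uu(t) = λ·tan(y(t)), Θ_ul(t) = Θ_ul, Θ_un(t) = Θ_un, Θ_ll(t) = c_ll/cos(y(t)) − (Θ_ul²/λ)·tan(y(t)), Θ_nn(t) = c_nn/cos(y(t))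 − (Θ_un²/λ)·tan(y(t)), and Θ_ln(t) = c_ln/cos(y(t)) − (Θ_ul·Θ_un/λ)·tan(y(t)). -/
open Real

/-- A function whose derivative within an order-connected set vanishes is constant there. -/
theorem Set.OrdConnected.eq_of_hasDerivWithinAt_zero {I : Set ℝ} (hI : I.OrdConnected)
    {f : ℝ → ℝ} (hf : ∀ t ∈ I, HasDerivWithinAt f 0 I t) {s t : ℝ} (hs : s ∈ I) (ht : t ∈ I) :
    f t = f s := by
  have h := hI.convex.norm_image_sub_le_of_norm_hasDerivWithin_le (C := 0) hf (by simp) hs ht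
  simpa [sub_eq_zero] using h

theorem Real.cos_arctan_div {l x : ℝ} (hl : 0 < l) :
    cos (arctan (x / l)) = l / √(l ^ 2 + x ^ 2) := by
  have h : l ^ 2 + x ^ 2 = l ^ 2 * (1 + (x / l) ^ 2) := by field_simp
  rw [Real.cos_arctan, h, Real.sqrt_mul (sq_nonneg l), Real.sqrt_sq hl.le]
  field_simp

/-- A solution of the Riccati equation `U' = β (U² + l²)` is `l` times the tangent of an angle
with derivative `l β`. -/
theorem arctan_div_eq_of_riccati {I : Set ℝ} (hI : I.OrdConnected) (h0 : (0 : ℝ) ∈ I)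
    {β y U : ℝ → ℝ} {l : ℝ} (hl : l ≠ 0)
    (hU : ∀ t ∈ I, HasDerivWithinAt U (β t * (U t ^ 2 + l ^ 2)) I t)
    (hy : ∀ t ∈ I, HasDerivWithinAt y (l * β t) I t) (hy0 : y 0 = arctan (U 0 / l))
    {t : ℝ} (ht : t ∈ I) : y t = arctan (U t / l) := by
  have h := hI.eq_of_hasDerivWithinAt_zero (f := fun t => y t - arctan (U t / l))
    (fun t ht => by
      refine ((hy t ht).sub ((hU t ht).div_const l).arctan).congr_deriv ?_
      have h1 : 1 + (U t / l) ^ 2 ≠ 0 := by positivity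
      have h2 : U t ^ 2 + l ^ 2 ≠ 0 := by positivity
      field_simp
      ring) h0 ht
  simp only [hy0, sub_self] at h
  exact sub_eq_zero.1 h

/-- Solutions of `F' = β (F U - a)`, where `U = l tan y` and `y' = l β`. -/
theorem eq_div_cos_sub_of_hasDerivWithinAt {I : Set ℝ} (hI : I.OrdConnected) (h0 : (0 : ℝ) ∈ I)
    {β y U F : ℝ → ℝ} {l a c : ℝ} (hl : 0 < l)
    (hU : ∀ t ∈ I, HasDerivWithinAt U (β t * (U t ^ 2 + l ^ 2)) I t)
    (hy : ∀ t ∈ I, HasDerivWithinAt y (l * β t) I t)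
    (hyU : ∀ t ∈ I, y t = arctan (U t / l))
    (hF : ∀ t ∈ I, HasDerivWithinAt F (β t * (F t * U t - a)) I t)
    (hc : c = (F 0 * l ^ 2 + a * U 0) / (l * √(l ^ 2 + U 0 ^ 2)))
    {t : ℝ} (ht : t ∈ I) : F t = c / cos (y t) - a / l * tan (y t) := by
  have hcos : ∀ t ∈ I, cos (y t) ≠ 0 := fun t ht => by
    rw [hyU t ht]
    exact (cos_arctan_pos _).ne'
  have htan : ∀ t ∈ I, U t = l * tan (y t) := fun t ht => by
    rw [hyU t ht, tan_arctan]
    field_simp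
  have h := hI.eq_of_hasDerivWithinAt_zero
    (f := fun t => (F t + a / l ^ 2 * U t) * cos (y t))
    (fun t ht => by
      refine (((hF t ht).add ((hU t ht).const_mul (a / l ^ 2))).mul (hy t ht).cos).congr_deriv ?_
      have hsin : l * sin (y t) = U t * cos (y t) := by
        rw [htan t ht, mul_assoc, tan_mul_cos (hcos t ht)]
      have hs : sin (y t) = U t * cos (y t) / l := by
        field_simp
        linarith
      simp only [Pi.add_apply, hs]
      field_simp
      ring) h0 ht
  have hc' : (F 0 + a / l ^ 2 * U 0) * cos (y 0) = c := by
    have : 0 < √(l ^ 2 + U 0 ^ 2) := by positivity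
    rw [hc, hyU 0 h0, cos_arctan_div hl]
    field_simp
  have hct := hcos t ht
  rw [← hc', ← h, mul_div_cancel_right₀ _ hct, htan t ht]
  field_simp
  ring

/-- Uniqueness part (Lemma 3.8 of the paper): any solution of the integrability
system of the left-invariant parallel spinor flow with non-quasi-diagonal
initial value (`λ = √(Θ_ul² + Θ_un²) > 0`) has initial data satisfying the
algebraic constraint equations and is given by the stated explicit formulas. -/
theorem stmt_4
    (β B : ℝ → ℝ) (hβ : Continuous β)
    (hB : ∀ t, B t = ∫ τ in (0:ℝ)..t, β τ)
    (I : Set ℝ) (hI : I.OrdConnected) (h0 : (0:ℝ) ∈ I)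
    (Fuu Ful Fun Fll Fln Fnn : ℝ → ℝ)
    -- the ODEs of the integrability system
    (hode : ∀ t ∈ I,
      HasDerivWithinAt Fuu (β t * ((Fuu t) ^ 2 + (Ful t) ^ 2 + (Fun t) ^ 2)) I t ∧
      HasDerivWithinAt Ful 0 I t ∧
      HasDerivWithinAt Fun 0 I t ∧
      HasDerivWithinAt Fll (β t * (Fll t * Fuu t - (Ful t) ^ 2)) I t ∧
      HasDerivWithinAt Fln (β t * (Fln t * Fuu t - Fun t * Ful t)) I t ∧
      HasDerivWithinAt Fnn (β t * (Fnn t * Fuu t - (Fun t) ^ 2)) I t)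
    -- the algebraic constraint equations at every time
    (halg : ∀ t ∈ I,
      Fln t * Ful t = Fll t * Fun t ∧
      Fln t * Fun t = Fnn t * Ful t ∧
      Fll t * Ful t + Fln t * Fun t + Ful t * Fuu t = 0 ∧
      Fln t * Ful t + Fnn t * Fun t + Fun t * Fuu t = 0)
    -- initial values
    (Θuu Θul Θun Θll Θln Θnn : ℝ)
    (h0uu : Fuu 0 = Θuu) (h0ul : Ful 0 = Θul) (h0un : Fun 0 = Θun)
    (h0ll : Fll 0 = Θll) (h0ln : Fln 0 = Θln) (h0nn : Fnn 0 = Θnn)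
    (lam : ℝ) (hlam : lam = Real.sqrt (Θul ^ 2 + Θun ^ 2)) (hlampos : 0 < lam)
    (y : ℝ → ℝ) (hy : ∀ t, y t = lam * B t + arctan (Θuu / lam))
    (cll cnn cln : ℝ)
    (hcll : cll = (Θll * lam ^ 2 + Θul ^ 2 * Θuu) / (lam * Real.sqrt (lam ^ 2 + Θuu ^ 2)))
    (hcnn : cnn = (Θnn * lam ^ 2 + Θun ^ 2 * Θuu) / (lam * Real.sqrt (lam ^ 2 + Θuu ^ 2)))
    (hcln : cln = (Θln * lam ^ 2 + Θul * Θun * Θuu) / (lam * Real.sqrt (lam ^ 2 + Θuu ^ 2))) :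
    -- the initial values satisfy the algebraic constraint equations
    (Θln * Θul = Θll * Θun ∧
     Θln * Θun = Θnn * Θul ∧
     Θll * Θul + Θln * Θun + Θul * Θuu = 0 ∧
     Θln * Θul + Θnn * Θun + Θun * Θuu = 0) ∧
    -- and the solution is given by the explicit formulas
    ∀ t ∈ I,
      cos (y t) ≠ 0 ∧
      Fuu t = lam * tan (y t) ∧
      Ful t = Θul ∧
      Fun t = Θun ∧
      Fll t = cll / cos (y t) - (Θul ^ 2 / lam) * tan (y t) ∧
      Fnn t = cnn / cos (y t) - (Θun ^ 2 / lam) * tan (y t) ∧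
      Fln t = cln / cos (y t) - (Θul * Θun / lam) * tan (y t) := by
  have hul : ∀ t ∈ I, Ful t = Θul := fun t ht =>
    (hI.eq_of_hasDerivWithinAt_zero (fun t ht => (hode t ht).2.1) h0 ht).trans h0ul
  have hun : ∀ t ∈ I, Fun t = Θun := fun t ht =>
    (hI.eq_of_hasDerivWithinAt_zero (fun t ht => (hode t ht).2.2.1) h0 ht).trans h0un
  have hlam2 : lam ^ 2 = Θul ^ 2 + Θun ^ 2 := by
    rw [hlam, Real.sq_sqrt (by positivity)]
  have hU : ∀ t ∈ I, HasDerivWithinAt Fuu (β t * (Fuu t ^ 2 + lam ^ 2)) I t := fun t ht =>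
    (hode t ht).1.congr_deriv (by rw [hul t ht, hun t ht, hlam2, add_assoc])
  have hyd : ∀ t ∈ I, HasDerivWithinAt y (lam * β t) I t := fun t _ => by
    rw [funext hy, funext hB]
    exact (((hβ.integral_hasStrictDerivAt 0 t).hasDerivAt.const_mul lam).add_const
      _).hasDerivWithinAt
  have hyU : ∀ t ∈ I, y t = arctan (Fuu t / lam) := fun t ht =>
    arctan_div_eq_of_riccati hI h0 hlampos.ne' hU hyd (by simp [hy, hB, h0uu]) ht
  subst h0uu h0ll h0ln h0nn
  refine ⟨by simpa only [h0ul, h0un] using halg 0 h0, fun t ht =>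
    ⟨?_, ?_, hul t ht, hun t ht, ?_, ?_, ?_⟩⟩
  · rw [hyU t ht]
    exact (cos_arctan_pos _).ne'
  · rw [hyU t ht, tan_arctan]
    field_simp
  · exact eq_div_cos_sub_of_hasDerivWithinAt hI h0 hlampos hU hyd hyU
      (fun s hs => (hode s hs).2.2.2.1.congr_deriv (by rw [hul s hs])) hcll ht
  · exact eq_div_cos_sub_of_hasDerivWithinAt hI h0 hlampos hU hyd hyU
      (fun s hs => (hode s hs).2.2.2.2.2.congr_deriv (by rw [hun s hs])) hcnn ht
  · exact eq_div_cos_sub_of_hasDerivWithinAt hI h0 hlampos hU hyd hyU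
      (fun s hs => (hode s hs).2.2.2.2.1.congr_deriv
        (by rw [hul s hs, hun s hs, mul_comm Θun])) hcln ht
end

section
/- Let (Θ_uu, Θ_ul, Θ_un, Θ_ll, Θ_ln, Θ_nn) be real numbers satisfying the algebraic constraint equations, and suppose Θ_ul·Θ_un ≠ 0. Then, with λ² := Θ_ul² + Θ_un², one has Θ_ll = (Θ_ul/Θ_un)·Θ_ln, Θ_nn = (Θ_un/Θ_ul)·Θ_ln, Θ_ln = −(Θ_ul·Θ_un/λ²)·Θ_uu, and Θ_uu = −(Θ_ll + Θ_nn). -/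
/-- If the algebraic constraint equations hold and `Θ_ul·Θ_un ≠ 0`, then with
`λ² = Θ_ul² + Θ_un²` one has `Θ_ll = (Θ_ul/Θ_un)·Θ_ln`,
`Θ_nn = (Θ_un/Θ_ul)·Θ_ln`, `Θ_ln = −(Θ_ul·Θ_un/λ²)·Θ_uu`
and `Θ_uu = −(Θ_ll + Θ_nn)`. -/
theorem stmt_6
    (Θuu Θul Θun Θll Θln Θnn : ℝ)
    (hc1 : Θln * Θul = Θll * Θun)
    (hc2 : Θln * Θun = Θnn * Θul)
    (hc3 : Θll * Θul + Θln * Θun + Θul * Θuu = 0)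
    (hc4 : Θln * Θul + Θnn * Θun + Θun * Θuu = 0)
    (hulun : Θul * Θun ≠ 0) :
    Θll = (Θul / Θun) * Θln ∧
    Θnn = (Θun / Θul) * Θln ∧
    Θln = -(Θul * Θun / (Θul ^ 2 + Θun ^ 2)) * Θuu ∧
    Θuu = -(Θll + Θnn) := by
  have hul : Θul ≠ 0 := left_ne_zero_of_mul hulun
  have hun : Θun ≠ 0 := right_ne_zero_of_mul hulun
  have hsq : Θul ^ 2 + Θun ^ 2 ≠ 0 := by positivity
  refine ⟨?_, ?_, ?_, ?_⟩
  · rw [div_mul_eq_mul_div, eq_div_iff hun]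
    linear_combination -hc1
  · rw [div_mul_eq_mul_div, eq_div_iff hul]
    linear_combination -hc2
  · rw [← neg_div, div_mul_eq_mul_div, eq_div_iff hsq]
    linear_combination Θun * hc3 + Θul * hc1
  · apply mul_left_cancel₀ hul
    linear_combination hc3 - hc2
end

section
/- Let β : ℝ → ℝ be continuous, B(t) = ∫₀ᵗ β(τ) dτ, Θ_uu ≠ 0 a real number, and θ a symmetric 2×2 real matrix. Suppose Q is an orthogonal 2×2 real matrix and ρ₊, ρ₋ real numbers with θ/Θ_uu = Q·diag(ρ₊, ρ₋)·Qᵀ. Let I ⊆ ℝ be an interval containing 0 on which 1 − Θ_uu·B(t) > 0. Define the 3×3 matrix family Θ(t) (indices u,l,n) with uu-entry Θ_uu/(1 − Θ_uu·B(t)), lower-right 2×2 block θ/(1 − Θ_uu·B(t)), and all entries mixing u with l,n equal to zero; and define U(t) with uu-entry 1 − Θ_uu·B(t), lower-right 2×2 block Q·diag((1 − Θ_uu·B(t))^{ρ₊}, (1 − Θ_uu·B(t))^{ρ₋})·Qᵀ, and remaining entries zero. Then U is the unique differentiable family of 3×3 real matrices on I satisfying the linear matrix ODE U'(t) + β(t)·Θ(t)·U(t)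 = 0 with U(0) = Id. -/
open Real Matrix

section DiagonalizedODE

variable {n : Type*} [Fintype n] [DecidableEq n]

theorem conj_diagonal_apply (P : Matrix n n ℝ) (d : n → ℝ) (i j : n) :
    (P * diagonal d * Pᵀ) i j = ∑ k, P i k * d k * P j k := by
  rw [Matrix.mul_apply]
  simp only [Matrix.mul_diagonal, Matrix.transpose_apply]

theorem conj_diagonal_mul_conj_diagonal {P : Matrix n n ℝ} (hP : Pᵀ * P = 1) (d e : n → ℝ) :
    P * diagonal d * Pᵀ * (P * diagonal e * Pᵀ) = P * diagonal (fun k => d k * e k) * Pᵀ := by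
  calc P * diagonal d * Pᵀ * (P * diagonal e * Pᵀ)
      = P * diagonal d * (Pᵀ * P) * diagonal e * Pᵀ := by simp only [Matrix.mul_assoc]
    _ = P * diagonal (fun k => d k * e k) * Pᵀ := by
      rw [hP, Matrix.mul_one, Matrix.mul_assoc P, diagonal_mul_diagonal]

/-- The family `P diag(w ^ p) Pᵀ` solves `U' = (w' / w) P diag(p) Pᵀ U`. -/
theorem hasDerivWithinAt_conj_diagonal_rpow {P : Matrix n n ℝ} (hP : Pᵀ * P = 1) (p : n → ℝ)
    {w : ℝ → ℝ} {w' t : ℝ} {I : Set ℝ} (hw : HasDerivWithinAt w w' I t) (hpos : 0 < w t)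
    (i j : n) :
    HasDerivWithinAt (fun s => (P * diagonal (fun k => w s ^ p k) * Pᵀ) i j)
      (w' / w t * (P * diagonal p * Pᵀ * (P * diagonal (fun k => w t ^ p k) * Pᵀ)) i j) I t := by
  simp only [conj_diagonal_mul_conj_diagonal hP, conj_diagonal_apply, Finset.mul_sum]
  refine HasDerivWithinAt.fun_sum fun k _ => ?_
  refine (((hw.rpow_const (p := p k) (Or.inl hpos.ne')).const_mul (P i k)).mul_const
    (P j k)).congr_deriv ?_
  rw [Real.rpow_sub_one hpos.ne']
  ring

theorem eq_rpow_mul_of_hasDerivWithinAt {I : Set ℝ} (hI : I.OrdConnected) {w w' x : ℝ → ℝ}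
    (p : ℝ) (hw : ∀ t ∈ I, HasDerivWithinAt w (w' t) I t) (hpos : ∀ t ∈ I, 0 < w t)
    (hx : ∀ t ∈ I, HasDerivWithinAt x (w' t / w t * (p * x t)) I t)
    {t₀ t : ℝ} (ht₀ : t₀ ∈ I) (hw₀ : w t₀ = 1) (ht : t ∈ I) :
    x t = w t ^ p * x t₀ := by
  have hderiv : ∀ s ∈ I, HasDerivWithinAt (fun s => w s ^ (-p) * x s) 0 I s := by
    intro s hs
    refine (((hw s hs).rpow_const (p := -p) (Or.inl (hpos s hs).ne')).mul (hx s hs)).congr_deriv ?_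
    rw [Real.rpow_sub_one (hpos s hs).ne']
    ring
  have hconst := hI.convex.norm_image_sub_le_of_norm_hasDerivWithin_le (C := 0) hderiv
    (by simp) ht₀ ht
  have heq : w t ^ (-p) * x t = x t₀ := by
    simpa [hw₀, sub_eq_zero] using hconst
  rw [← heq, ← mul_assoc, ← Real.rpow_add (hpos t ht), add_neg_cancel, Real.rpow_zero, one_mul]

/-- Solutions of `V' = (w' / w) P diag(p) Pᵀ V` are determined by their value where `w = 1`. -/
theorem eq_conj_diagonal_rpow_mul {I : Set ℝ} (hI : I.OrdConnected) {P : Matrix n n ℝ}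
    (hP : Pᵀ * P = 1) (p : n → ℝ) {w w' : ℝ → ℝ}
    (hw : ∀ t ∈ I, HasDerivWithinAt w (w' t) I t) (hpos : ∀ t ∈ I, 0 < w t)
    {V : ℝ → Matrix n n ℝ}
    (hV : ∀ t ∈ I, ∀ i j, HasDerivWithinAt (fun s => V s i j)
      (w' t / w t * (P * diagonal p * Pᵀ * V t) i j) I t)
    {t₀ t : ℝ} (ht₀ : t₀ ∈ I) (hw₀ : w t₀ = 1) (ht : t ∈ I) :
    V t = P * diagonal (fun k => w t ^ p k) * Pᵀ * V t₀ := by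
  have hP' : P * Pᵀ = 1 := mul_eq_one_comm.mp hP
  have hX : Pᵀ * V t = diagonal (fun k => w t ^ p k) * (Pᵀ * V t₀) := by
    ext i j
    rw [diagonal_mul]
    refine eq_rpow_mul_of_hasDerivWithinAt (x := fun s => (Pᵀ * V s) i j) hI (p i) hw hpos
      (fun s hs => ?_) ht₀ hw₀ ht
    have hconj : Pᵀ * (P * diagonal p * Pᵀ * V s) = diagonal p * (Pᵀ * V s) := by
      simp only [← Matrix.mul_assoc, hP, Matrix.one_mul]
    rw [← diagonal_mul, ← hconj]
    simp only [Matrix.mul_apply (M := Pᵀ), Finset.mul_sum]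
    refine HasDerivWithinAt.fun_sum fun k _ => ?_
    exact ((hV s hs k j).const_mul (Pᵀ i k)).congr_deriv (by ring)
  calc V t = P * (Pᵀ * V t) := by rw [← Matrix.mul_assoc, hP', Matrix.one_mul]
    _ = _ := by rw [hX]; simp only [Matrix.mul_assoc]

end DiagonalizedODE

theorem fromBlocks_conj_diagonal {m n : Type*} [Fintype m] [Fintype n] [DecidableEq m]
    [DecidableEq n] (Q : Matrix n n ℝ) (d : m → ℝ) (e : n → ℝ) :
    fromBlocks 1 0 0 Q * diagonal (Sum.elim d e) * (fromBlocks (1 : Matrix m m ℝ) 0 0 Q)ᵀ =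
      fromBlocks (diagonal d) 0 0 (Q * diagonal e * Qᵀ) := by
  simp [← fromBlocks_diagonal, fromBlocks_transpose, fromBlocks_multiply]

/-- Explicit solution of the coframe evolution equation `U' + β Θ U = 0` of the
quasi-diagonal left-invariant parallel spinor flow (`Θ_ul = Θ_un = 0`,
`Θ_uu ≠ 0`); `3×3` matrices are indexed by `Fin 1 ⊕ Fin 2`, the `Fin 1` index
being `u` and the `Fin 2` block carrying the indices `l, n`. -/
theorem stmt_7
    (β B : ℝ → ℝ) (hβ : Continuous β)
    (hB : ∀ t, B t = ∫ τ in (0:ℝ)..t, β τ)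
    (Θuu : ℝ) (hΘuu : Θuu ≠ 0)
    (θ : Matrix (Fin 2) (Fin 2) ℝ) (hθ : θ.IsSymm)
    (Q : Matrix (Fin 2) (Fin 2) ℝ) (hQ : Qᵀ * Q = 1)
    (ρp ρm : ℝ)
    (hdiag : θ = Θuu • (Q * Matrix.diagonal ![ρp, ρm] * Qᵀ))
    (I : Set ℝ) (hI : I.OrdConnected) (h0 : (0:ℝ) ∈ I)
    (hden : ∀ t ∈ I, 0 < 1 - Θuu * B t)
    (Θm U : ℝ → Matrix (Fin 1 ⊕ Fin 2) (Fin 1 ⊕ Fin 2) ℝ)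
    (hΘm : ∀ t, Θm t =
      (1 - Θuu * B t)⁻¹ • Matrix.fromBlocks !![Θuu] 0 0 θ)
    (hU : ∀ t, U t = Matrix.fromBlocks !![1 - Θuu * B t] 0 0
      (Q * Matrix.diagonal ![(1 - Θuu * B t) ^ ρp, (1 - Θuu * B t) ^ ρm] * Qᵀ)) :
    -- U is differentiable and solves U' + β Θ U = 0 on I with U(0) = Id
    ((∀ t ∈ I, ∀ i j, HasDerivWithinAt (fun s => U s i j)
        (-(β t * (Θm t * U t) i j)) I t) ∧ U 0 = 1) ∧
    -- and it is the unique such family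
    ∀ V : ℝ → Matrix (Fin 1 ⊕ Fin 2) (Fin 1 ⊕ Fin 2) ℝ,
      (∀ t ∈ I, ∀ i j, HasDerivWithinAt (fun s => V s i j)
        (-(β t * (Θm t * V t) i j)) I t) → V 0 = 1 →
      ∀ t ∈ I, V t = U t := by
  set w : ℝ → ℝ := fun t => 1 - Θuu * B t with hw_def
  set P : Matrix (Fin 1 ⊕ Fin 2) (Fin 1 ⊕ Fin 2) ℝ := fromBlocks 1 0 0 Q with hP_def
  set p : Fin 1 ⊕ Fin 2 → ℝ := Sum.elim ![1] ![ρp, ρm] with hp_def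
  have hP : Pᵀ * P = 1 := by
    simp [hP_def, fromBlocks_transpose, fromBlocks_multiply, hQ]
  have hw : ∀ t ∈ I, HasDerivWithinAt w (-(Θuu * β t)) I t := by
    intro t _
    have hBt : HasDerivAt B (β t) t := by
      rw [funext hB]
      exact intervalIntegral.integral_hasDerivAt_right (hβ.intervalIntegrable _ _)
        hβ.stronglyMeasurable.stronglyMeasurableAtFilter hβ.continuousAt
    exact ((hBt.const_mul Θuu).const_sub 1).hasDerivWithinAt
  have hw₀ : w 0 = 1 := by simp [hw_def, hB]
  have hU' : ∀ t, U t = P * diagonal (fun k => w t ^ p k) * Pᵀ := by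
    intro t
    have hpow : (fun k => w t ^ p k) = Sum.elim ![w t] ![w t ^ ρp, w t ^ ρm] := by
      ext k
      rcases k with k | k <;> fin_cases k <;> simp [hp_def]
    rw [hpow, hP_def, fromBlocks_conj_diagonal, hU]
    congr 1
    ext i j
    fin_cases i; fin_cases j; simp [hw_def]
  have hΘm' : ∀ t, Θm t = (Θuu / w t) • (P * diagonal p * Pᵀ) := by
    intro t
    rw [hΘm, hP_def, hp_def, fromBlocks_conj_diagonal, hdiag, div_eq_inv_mul, mul_smul,
      fromBlocks_smul Θuu]
    congr 2
    · ext i j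
      fin_cases i; fin_cases j; simp
    · simp
    · simp
  have hrhs : ∀ t (M : Matrix (Fin 1 ⊕ Fin 2) (Fin 1 ⊕ Fin 2) ℝ) i j,
      -(β t * (Θm t * M) i j) = -(Θuu * β t) / w t * (P * diagonal p * Pᵀ * M) i j := by
    intro t M i j
    rw [hΘm', Matrix.smul_mul, Matrix.smul_apply, smul_eq_mul]
    ring
  have hU₀ : U 0 = 1 := by
    simp [hU', hw₀, mul_eq_one_comm.mp hP]
  refine ⟨⟨fun t ht i j => ?_, hU₀⟩, fun V hV hV₀ t ht => ?_⟩
  · simp only [hrhs, hU']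
    exact hasDerivWithinAt_conj_diagonal_rpow hP p (hw t ht) (hden t ht) i j
  · simp only [hrhs] at hV
    rw [eq_conj_diagonal_rpow_mul hI hP p hw hden hV h0 hw₀ ht, hV₀, Matrix.mul_one, hU']
end

section
/- Let Θ_ul, Θ_un, T, b, y be real numbers with Θ_ul·Θ_un ≠ 0 and cos(y) ≠ 0; set λ = √(Θ_ul² + Θ_un²) and Θ_uu = −T. Let U be the 3×3 real matrix (indices u,l,n) with U_uu = 1 − Θ_uu·b, U_ul = −Θ_ul·b, U_un = −Θ_un·b, U_lu = (Θ_ul/λ)·(Θ_uu/λ − (1 − Θ_uu·b)·tan(y)), U_ll = 1 + (Θ_ul²·b/λ)·tan(y), U_ln = (Θ_ul·Θ_un·b/λ)·tan(y), U_nu = (Θ_un/λ)·(Θ_uu/λ − (1 − Θ_uu·b)·tan(y)), U_nl = (Θ_ul·Θ_un·b/λ)·tan(y), U_nn = 1 + (Θ_un²·b/λ)·tan(y). Then the Gram matrix G = Uᵀ·U has entries G_uu = (1 + T·b)² + (tan(y)·(1 + T·b) + T/λ)², G_ul = G_lu = −(T/λ² + (tan(y)/λ)·(1 + 2·T·b)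 + b·(1 + T·b)/cos²(y))·Θ_ul, G_un = G_nu = −(T/λ² + (tan(y)/λ)·(1 + 2·T·b) + b·(1 + T·b)/cos²(y))·Θ_un, G_ll = 1 + Θ_ul²·b·(b/cos²(y) + 2·tan(y)/λ), G_ln = G_nl = Θ_ul·Θ_un·b·(b/cos²(y) + 2·tan(y)/λ), G_nn = 1 + Θ_un²·b·(b/cos²(y) + 2·tan(y)/λ). -/
open Real Matrix

/-- Gram matrix (i.e. the evolved Riemannian metric in the initial coframe) of
the coframe evolution matrix of the left-invariant parallel spinor flow with
`Θ_ul·Θ_un ≠ 0`, where `T = −Θ_uu`; `3×3` matrices are indexed by `Fin 3` with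
`0 = u`, `1 = l`, `2 = n`. -/
theorem stmt_12
    (Θul Θun T b y : ℝ) (hΘ : Θul * Θun ≠ 0) (hcos : cos y ≠ 0)
    (lam : ℝ) (hlam : lam = Real.sqrt (Θul ^ 2 + Θun ^ 2))
    (Θuu : ℝ) (hΘuu : Θuu = -T)
    (U : Matrix (Fin 3) (Fin 3) ℝ)
    (hU : U =
      !![1 - Θuu * b,
         -(Θul * b),
         -(Θun * b);
         (Θul / lam) * (Θuu / lam - (1 - Θuu * b) * tan y),
         1 + (Θul ^ 2 * b / lam) * tan y,
         (Θul * Θun * b / lam) * tan y;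
         (Θun / lam) * (Θuu / lam - (1 - Θuu * b) * tan y),
         (Θul * Θun * b / lam) * tan y,
         1 + (Θun ^ 2 * b / lam) * tan y]) :
    Uᵀ * U =
      !![(1 + T * b) ^ 2 + (tan y * (1 + T * b) + T / lam) ^ 2,
         -(T / lam ^ 2 + (tan y / lam) * (1 + 2 * (T * b))
             + b * (1 + T * b) / cos y ^ 2) * Θul,
         -(T / lam ^ 2 + (tan y / lam) * (1 + 2 * (T * b))
             + b * (1 + T * b) / cos y ^ 2) * Θun;
         -(T / lam ^ 2 + (tan y / lam) * (1 + 2 * (T * b))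
             + b * (1 + T * b) / cos y ^ 2) * Θul,
         1 + Θul ^ 2 * b * (b / cos y ^ 2 + 2 * tan y / lam),
         Θul * Θun * b * (b / cos y ^ 2 + 2 * tan y / lam);
         -(T / lam ^ 2 + (tan y / lam) * (1 + 2 * (T * b))
             + b * (1 + T * b) / cos y ^ 2) * Θun,
         Θul * Θun * b * (b / cos y ^ 2 + 2 * tan y / lam),
         1 + Θun ^ 2 * b * (b / cos y ^ 2 + 2 * tan y / lam)] := by
  have hsq : lam ^ 2 = Θul ^ 2 + Θun ^ 2 := by
    rw [hlam, Real.sq_sqrt (by positivity)]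
  have hne : lam ≠ 0 := by
    have hpos : 0 < Θul ^ 2 := sq_pos_of_ne_zero (left_ne_zero_of_mul hΘ)
    intro h
    rw [h] at hsq
    nlinarith [sq_nonneg Θun]
  have hinv : lam⁻¹ ^ 2 * (Θul ^ 2 + Θun ^ 2) = 1 := by
    rw [← hsq]
    field_simp
  have hsec : (cos y ^ 2)⁻¹ = 1 + tan y ^ 2 := by
    rw [← Real.inv_one_add_tan_sq hcos, inv_inv]
  subst hU hΘuu
  clear hlam hsq
  simp only [div_eq_mul_inv, hsec, ← inv_pow]
  generalize lam⁻¹ = r at *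
  generalize tan y = t at *
  ext i j
  fin_cases i <;> fin_cases j <;>
    simp [Matrix.mul_apply, Fin.sum_univ_three]
  · linear_combination (T * r + (1 + T * b) * t) ^ 2 * hinv
  · linear_combination -(Θul * b * t * (T * r + (1 + T * b) * t)) * hinv
  · linear_combination -(Θun * b * t * (T * r + (1 + T * b) * t)) * hinv
  · linear_combination -(Θul * b * t * (T * r + (1 + T * b) * t)) * hinv
  · linear_combination Θul ^ 2 * b ^ 2 * t ^ 2 * hinv
  · linear_combination Θul * Θun * b ^ 2 * t ^ 2 * hinv
  · linear_combination -(Θun * b * t * (T * r + (1 + T * b) * t)) * hinv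
  · linear_combination Θul * Θun * b ^ 2 * t ^ 2 * hinv
  · linear_combination Θun ^ 2 * b ^ 2 * t ^ 2 * hinv
end
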